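/- The algebra (Q^{U_n})^{S₃} of polynomials in Q invariant under both U_n and the column-permutation action of S₃ is spanned as a ℂ-vector space by the set {α₁^a α₂^b α₃^c (γ₁²)^d (γ₂²)^e (γ₁γ₂)^f : a, b, c, d, e, f ∈ ℤ_{≥0}}; in particular, (Q^{U_n})^{S₃} is generated as a ℂ-algebra by the six elements α₁, α₂, α₃, γ₁², γ₂², γ₁γ₂. -/

import Mathlib

open MvPolynomial

noncomputable section

/-- The polynomial ring `𝒫 = ℂ[x_{ij} : 1 ≤ i ≤ n, 1 ≤ j ≤ 3]` in the entries of an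
`n × 3` matrix of indeterminates. -/
abbrev P (n : ℕ) : Type := MvPolynomial (Fin n × Fin 3) ℂ

/-- The action of a matrix `g` on `𝒫`, given by `(g · f)(X) = f(gᵀ X)`;
on variables it sends `x_{ij} ↦ ∑ s g_{si} x_{sj}`. -/
def matAct (n : ℕ) (g : Matrix (Fin n) (Fin n) ℂ) : P n →ₐ[ℂ] P n :=
  aeval fun p : Fin n × Fin 3 => ∑ s : Fin n, C (g s p.1) * X (s, p.2)

/-- The action of `σ ∈ S₃` permuting columns: `x_{ij} ↦ x_{iσ(j)}`. -/
def permAct (n : ℕ) (σ : Equiv.Perm (Fin 3)) : P n →ₐ[ℂ] P n :=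
  aeval fun p : Fin n × Fin 3 => X (p.1, σ p.2)

/-- `g` is upper triangular with all diagonal entries equal to `1`, i.e. `g ∈ U_n`. -/
def IsUpperUni (n : ℕ) (g : Matrix (Fin n) (Fin n) ℂ) : Prop :=
  (∀ i, g i i = 1) ∧ ∀ i j, j < i → g i j = 0

/-- `f` is `U_n`-invariant. -/
def UInv (n : ℕ) (f : P n) : Prop :=
  ∀ g : Matrix (Fin n) (Fin n) ℂ, IsUpperUni n g → matAct n g f = f

/-- `f ∈ Q_m` : each monomial of `f` has total degree `m` in the column-`j` variables,
for each `j`. -/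
def InQm (n m : ℕ) (f : P n) : Prop :=
  ∀ d ∈ f.support, ∀ j : Fin 3, (∑ i : Fin n, d (i, j)) = m

/-- `f ∈ Q = ⊕ₘ Q_m` : each monomial of `f` has equal total degree in the three columns. -/
def InQ (n : ℕ) (f : P n) : Prop :=
  ∀ d ∈ f.support, ∀ j : Fin 3, (∑ i : Fin n, d (i, j)) = ∑ i : Fin n, d (i, (0 : Fin 3))

/-- The variable `x_{(i+1)(j+1)}`, `i j : Fin 3` (0-indexed rows and columns). -/
def Xe (n : ℕ) (hn : 3 ≤ n) (i j : Fin 3) : P n := X (Fin.castLE hn i, j)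

/-- `δ_{ij} = x_{1i} x_{2j} - x_{2i} x_{1j}` (0-indexed columns `i j : Fin 3`). -/
def del (n : ℕ) (hn : 3 ≤ n) (i j : Fin 3) : P n :=
  Xe n hn 0 i * Xe n hn 1 j - Xe n hn 1 i * Xe n hn 0 j

/-- `α₁ = x₁₁ x₁₂ x₁₃`. -/
def alpha1 (n : ℕ) (hn : 3 ≤ n) : P n := Xe n hn 0 0 * Xe n hn 0 1 * Xe n hn 0 2

/-- `β₂ = x₁₂ δ₁₃`. -/
def beta2 (n : ℕ) (hn : 3 ≤ n) : P n := Xe n hn 0 1 * del n hn 0 2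

/-- `β₃ = x₁₃ δ₁₂`. -/
def beta3 (n : ℕ) (hn : 3 ≤ n) : P n := Xe n hn 0 2 * del n hn 0 1

/-- `γ₁ = det (x_{ij})_{1 ≤ i,j ≤ 3}`. -/
def gamma1 (n : ℕ) (hn : 3 ≤ n) : P n := Matrix.det (Matrix.of fun i j : Fin 3 => Xe n hn i j)

/-- `γ₂ = δ₁₂ δ₁₃ δ₂₃`. -/
def gamma2 (n : ℕ) (hn : 3 ≤ n) : P n := del n hn 0 1 * del n hn 0 2 * del n hn 1 2

/-- `α₂ = β₂² + β₃² − β₂ β₃`. -/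
def alpha2 (n : ℕ) (hn : 3 ≤ n) : P n := beta2 n hn ^ 2 + beta3 n hn ^ 2 - beta2 n hn * beta3 n hn

/-- `α₃ = 2(β₂³ + β₃³) − 3(β₂² β₃ + β₂ β₃²)`. -/
def alpha3 (n : ℕ) (hn : 3 ≤ n) : P n :=
  2 * (beta2 n hn ^ 3 + beta3 n hn ^ 3) -
    3 * (beta2 n hn ^ 2 * beta3 n hn + beta2 n hn * beta3 n hn ^ 2)

/-- The spanning family `α₁^a α₂^b α₃^c (γ₁²)^d (γ₂²)^e (γ₁γ₂)^f`, `a b c d e f : ℕ`. -/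
def Sinv (n : ℕ) (hn : 3 ≤ n) : ℕ × ℕ × ℕ × ℕ × ℕ × ℕ → P n
  | (a, b, c, d, e, f) =>
      alpha1 n hn ^ a * alpha2 n hn ^ b * alpha3 n hn ^ c *
        (gamma1 n hn ^ 2) ^ d * (gamma2 n hn ^ 2) ^ e * (gamma1 n hn * gamma2 n hn) ^ f

section Gradings

/-- The weight of `x_{ij}` for the column multigrading. -/
def colWeight (n : ℕ) : Fin n × Fin 3 → (Fin 3 → ℕ) := fun p => Pi.single p.2 1

theorem weight_colWeight {n : ℕ} (d : Fin n × Fin 3 →₀ ℕ) (j : Fin 3) :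
    Finsupp.weight (colWeight n) d j = ∑ i : Fin n, d (i, j) := by
  rw [Finsupp.weight_apply, Finsupp.sum_fintype _ _ (by simp), Finset.sum_apply,
    Fintype.sum_prod_type]
  refine Finset.sum_congr rfl fun i _ => ?_
  simp [colWeight, Pi.single_apply]

theorem InQ.of_isWeightedHomogeneous {n : ℕ} {f : P n} {m : Fin 3 → ℕ}
    (h : IsWeightedHomogeneous (colWeight n) f m) (hm : ∀ j, m j = m 0) : InQ n f := by
  intro d hd j
  have := h (mem_support_iff.mp hd)
  rw [← weight_colWeight, ← weight_colWeight, this, hm]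

theorem InQ.add {n : ℕ} {f g : P n} (hf : InQ n f) (hg : InQ n g) : InQ n (f + g) := by
  classical
  intro d hd
  rcases Finset.mem_union.mp (support_add hd) with h | h
  exacts [hf d h, hg d h]

theorem InQ.mul {n : ℕ} {f g : P n} (hf : InQ n f) (hg : InQ n g) : InQ n (f * g) := by
  classical
  intro d hd j
  obtain ⟨a, ha, b, hb, rfl⟩ := Finset.mem_add.mp (support_mul _ _ hd)
  simp only [Finsupp.add_apply, Finset.sum_add_distrib, hf a ha j, hg b hb j]

theorem InQ.C {n : ℕ} (c : ℂ) : InQ n (C c) :=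
  .of_isWeightedHomogeneous (isWeightedHomogeneous_C _ c) (fun _ => rfl)

variable {n : ℕ} (hn : 3 ≤ n)

theorem isWeightedHomogeneous_Xe (i j : Fin 3) :
    IsWeightedHomogeneous (colWeight n) (Xe n hn i j) (Pi.single j 1) :=
  isWeightedHomogeneous_X _ _ _

theorem isWeightedHomogeneous_del (i j : Fin 3) :
    IsWeightedHomogeneous (colWeight n) (del n hn i j) (Pi.single i 1 + Pi.single j 1) := by
  refine ((isWeightedHomogeneous_Xe hn 0 i).mul (isWeightedHomogeneous_Xe hn 1 j)).sub ?_
  exact (isWeightedHomogeneous_Xe hn 1 i).mul (isWeightedHomogeneous_Xe hn 0 j)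

theorem gamma1_eq : gamma1 n hn = Xe n hn 2 0 * del n hn 1 2 - Xe n hn 2 1 * del n hn 0 2
    + Xe n hn 2 2 * del n hn 0 1 := by
  simp only [gamma1, Matrix.det_fin_three, Matrix.of_apply, del]
  ring

theorem inQ_alpha1 : InQ n (alpha1 n hn) :=
  .of_isWeightedHomogeneous (((isWeightedHomogeneous_Xe hn 0 0).mul
    (isWeightedHomogeneous_Xe hn 0 1)).mul (isWeightedHomogeneous_Xe hn 0 2)) (by decide)

theorem inQ_beta2 : InQ n (beta2 n hn) :=
  .of_isWeightedHomogeneous ((isWeightedHomogeneous_Xe hn 0 1).mul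
    (isWeightedHomogeneous_del hn 0 2)) (by decide)

theorem inQ_beta3 : InQ n (beta3 n hn) :=
  .of_isWeightedHomogeneous ((isWeightedHomogeneous_Xe hn 0 2).mul
    (isWeightedHomogeneous_del hn 0 1)) (by decide)

theorem inQ_gamma2 : InQ n (gamma2 n hn) :=
  .of_isWeightedHomogeneous (((isWeightedHomogeneous_del hn 0 1).mul
    (isWeightedHomogeneous_del hn 0 2)).mul (isWeightedHomogeneous_del hn 1 2)) (by decide)

theorem inQ_gamma1 : InQ n (gamma1 n hn) := by
  have h (i j k : Fin 3) := (isWeightedHomogeneous_Xe hn 2 i).mul (isWeightedHomogeneous_del hn j k)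
  rw [gamma1_eq, sub_eq_add_neg, ← neg_one_mul, ← C_1, ← C_neg]
  refine .add (.add ?_ (.mul (.C _) ?_)) ?_
  exacts [.of_isWeightedHomogeneous (h 0 1 2) (by decide),
    .of_isWeightedHomogeneous (h 1 0 2) (by decide), .of_isWeightedHomogeneous (h 2 0 1) (by decide)]

end Gradings

section Invariants

variable {n : ℕ} (hn : 3 ≤ n)

theorem matAct_Xe {g : Matrix (Fin n) (Fin n) ℂ} (hg : IsUpperUni n g) (i j : Fin 3) :
    matAct n g (Xe n hn i j) =
      ∑ s : Fin 3, C (g (Fin.castLE hn s) (Fin.castLE hn i)) * Xe n hn s j := by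
  simp only [matAct, Xe, aeval_X]
  refine (Fintype.sum_of_injective (Fin.castLE hn) (Fin.castLE_injective hn) _ _ ?_ ?_).symm
  · intro s hs
    have : Fin.castLE hn i < s := by
      by_contra h
      refine hs ⟨⟨s, lt_of_le_of_lt (not_lt.mp h) i.2⟩, rfl⟩
    simp [hg.2 _ _ this]
  · simp

theorem matAct_Xe_zero {g : Matrix (Fin n) (Fin n) ℂ} (hg : IsUpperUni n g) (j : Fin 3) :
    matAct n g (Xe n hn 0 j) = Xe n hn 0 j := by
  have h1 : g (Fin.castLE hn 1) (Fin.castLE hn 0) = 0 := hg.2 _ _ (by simp [Fin.lt_def])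
  have h2 : g (Fin.castLE hn 2) (Fin.castLE hn 0) = 0 := hg.2 _ _ (by simp [Fin.lt_def])
  rw [matAct_Xe hn hg, Fin.sum_univ_three, h1, h2, hg.1]
  simp

theorem matAct_Xe_one {g : Matrix (Fin n) (Fin n) ℂ} (hg : IsUpperUni n g) (j : Fin 3) :
    matAct n g (Xe n hn 1 j) =
      C (g (Fin.castLE hn 0) (Fin.castLE hn 1)) * Xe n hn 0 j + Xe n hn 1 j := by
  have h2 : g (Fin.castLE hn 2) (Fin.castLE hn 1) = 0 := hg.2 _ _ (by simp [Fin.lt_def])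
  rw [matAct_Xe hn hg, Fin.sum_univ_three, h2, hg.1]
  simp

theorem matAct_Xe_two {g : Matrix (Fin n) (Fin n) ℂ} (hg : IsUpperUni n g) (j : Fin 3) :
    matAct n g (Xe n hn 2 j) =
      C (g (Fin.castLE hn 0) (Fin.castLE hn 2)) * Xe n hn 0 j +
        C (g (Fin.castLE hn 1) (Fin.castLE hn 2)) * Xe n hn 1 j + Xe n hn 2 j := by
  rw [matAct_Xe hn hg, Fin.sum_univ_three, hg.1]
  simp

theorem matAct_del {g : Matrix (Fin n) (Fin n) ℂ} (hg : IsUpperUni n g) (i j : Fin 3) :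
    matAct n g (del n hn i j) = del n hn i j := by
  simp only [del, map_sub, map_mul, matAct_Xe_zero hn hg, matAct_Xe_one hn hg]
  ring

theorem uInv_alpha1 : UInv n (alpha1 n hn) := fun g hg => by
  simp only [alpha1, map_mul, matAct_Xe_zero hn hg]

theorem uInv_beta2 : UInv n (beta2 n hn) := fun g hg => by
  simp only [beta2, map_mul, matAct_Xe_zero hn hg, matAct_del hn hg]

theorem uInv_beta3 : UInv n (beta3 n hn) := fun g hg => by
  simp only [beta3, map_mul, matAct_Xe_zero hn hg, matAct_del hn hg]

theorem uInv_gamma1 : UInv n (gamma1 n hn) := fun g hg => by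
  simp only [gamma1_eq, map_mul, map_sub, map_add, matAct_Xe_two hn hg, matAct_del hn hg]
  simp only [del]
  ring

theorem uInv_gamma2 : UInv n (gamma2 n hn) := fun g hg => by
  simp only [gamma2, map_mul, matAct_del hn hg]

/-- The algebra of `U_n`-invariants in `Q`. -/
def unipotentInvariants (n : ℕ) : Subalgebra ℂ (P n) where
  carrier := {f | InQ n f ∧ UInv n f}
  mul_mem' hf hg := ⟨hf.1.mul hg.1, fun g h => by rw [map_mul, hf.2 g h, hg.2 g h]⟩
  add_mem' hf hg := ⟨hf.1.add hg.1, fun g h => by rw [map_add, hf.2 g h, hg.2 g h]⟩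
  algebraMap_mem' c := ⟨.C c, fun g _ => by rw [AlgHom.commutes]⟩

/-- The algebra of polynomials invariant under permutations of the columns. -/
def permInvariants (n : ℕ) : Subalgebra ℂ (P n) where
  carrier := {f | ∀ σ : Equiv.Perm (Fin 3), permAct n σ f = f}
  mul_mem' hf hg := fun σ => by rw [map_mul, hf σ, hg σ]
  add_mem' hf hg := fun σ => by rw [map_add, hf σ, hg σ]
  algebraMap_mem' c := fun σ => by rw [AlgHom.commutes]

theorem permAct_Xe (σ : Equiv.Perm (Fin 3)) (i j : Fin 3) :
    permAct n σ (Xe n hn i j) = Xe n hn i (σ j) := by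
  simp [permAct, Xe]

theorem permAct_mul (σ τ : Equiv.Perm (Fin 3)) (f : P n) :
    permAct n (σ * τ) f = permAct n σ (permAct n τ f) := by
  have : permAct n (σ * τ) = (permAct n σ).comp (permAct n τ) := by
    ext p
    simp [permAct]
  rw [this, AlgHom.comp_apply]

/-- Invariance under all column permutations follows from invariance under the two
adjacent transpositions. -/
theorem mem_permInvariants_of_swap {f : P n} (h0 : permAct n (Equiv.swap 0 1) f = f)
    (h1 : permAct n (Equiv.swap 1 2) f = f) : f ∈ permInvariants n := by
  intro σ
  have key : ∀ σ : Equiv.Perm (Fin 3), σ = 1 ∨ σ = Equiv.swap 0 1 ∨ σ = Equiv.swap 1 2 ∨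
      σ = Equiv.swap 0 1 * Equiv.swap 1 2 ∨ σ = Equiv.swap 1 2 * Equiv.swap 0 1 ∨
      σ = Equiv.swap 0 1 * (Equiv.swap 1 2 * Equiv.swap 0 1) := by decide
  have hone : permAct n 1 f = f := by
    have : permAct n 1 = AlgHom.id ℂ (P n) := by
      ext p
      simp [permAct]
    rw [this, AlgHom.id_apply]
  rcases key σ with rfl | rfl | rfl | rfl | rfl | rfl <;>
    simp only [permAct_mul, h0, h1, hone]

theorem swap_values : (Equiv.swap 0 1 : Equiv.Perm (Fin 3)) 0 = 1 ∧
    (Equiv.swap 0 1 : Equiv.Perm (Fin 3)) 1 = 0 ∧ (Equiv.swap 0 1 : Equiv.Perm (Fin 3)) 2 = 2 ∧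
    (Equiv.swap 1 2 : Equiv.Perm (Fin 3)) 0 = 0 ∧ (Equiv.swap 1 2 : Equiv.Perm (Fin 3)) 1 = 2 ∧
    (Equiv.swap 1 2 : Equiv.Perm (Fin 3)) 2 = 1 := by decide

theorem permAct_swap01 :
    permAct n (Equiv.swap 0 1) (alpha1 n hn) = alpha1 n hn ∧
    permAct n (Equiv.swap 0 1) (beta2 n hn) = beta2 n hn - beta3 n hn ∧
    permAct n (Equiv.swap 0 1) (beta3 n hn) = - beta3 n hn ∧
    permAct n (Equiv.swap 0 1) (gamma1 n hn) = - gamma1 n hn ∧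
    permAct n (Equiv.swap 0 1) (gamma2 n hn) = - gamma2 n hn := by
  obtain ⟨h0, h1, h2, -⟩ := swap_values
  refine ⟨?_, ?_, ?_, ?_, ?_⟩ <;>
    simp only [alpha1, beta2, beta3, gamma1_eq, gamma2, del, map_mul, map_sub, map_add,
      permAct_Xe, h0, h1, h2] <;>
    ring

theorem permAct_swap12 :
    permAct n (Equiv.swap 1 2) (alpha1 n hn) = alpha1 n hn ∧
    permAct n (Equiv.swap 1 2) (beta2 n hn) = beta3 n hn ∧
    permAct n (Equiv.swap 1 2) (beta3 n hn) = beta2 n hn ∧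
    permAct n (Equiv.swap 1 2) (gamma1 n hn) = - gamma1 n hn ∧
    permAct n (Equiv.swap 1 2) (gamma2 n hn) = - gamma2 n hn := by
  obtain ⟨-, -, -, h0, h1, h2⟩ := swap_values
  refine ⟨?_, ?_, ?_, ?_, ?_⟩ <;>
    simp only [alpha1, beta2, beta3, gamma1_eq, gamma2, del, map_mul, map_sub, map_add,
      permAct_Xe, h0, h1, h2] <;>
    ring

/-- The algebra generated by `α₁, α₂, α₃, γ₁², γ₂², γ₁γ₂`. -/
def genAlgebra (n : ℕ) (hn : 3 ≤ n) : Subalgebra ℂ (P n) :=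
  Algebra.adjoin ℂ {alpha1 n hn, alpha2 n hn, alpha3 n hn, gamma1 n hn ^ 2, gamma2 n hn ^ 2,
    gamma1 n hn * gamma2 n hn}

theorem genAlgebra_le_unipotentInvariants : genAlgebra n hn ≤ unipotentInvariants n := by
  have a1 : alpha1 n hn ∈ unipotentInvariants n := ⟨inQ_alpha1 hn, uInv_alpha1 hn⟩
  have b2 : beta2 n hn ∈ unipotentInvariants n := ⟨inQ_beta2 hn, uInv_beta2 hn⟩
  have b3 : beta3 n hn ∈ unipotentInvariants n := ⟨inQ_beta3 hn, uInv_beta3 hn⟩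
  have g1 : gamma1 n hn ∈ unipotentInvariants n := ⟨inQ_gamma1 hn, uInv_gamma1 hn⟩
  have g2 : gamma2 n hn ∈ unipotentInvariants n := ⟨inQ_gamma2 hn, uInv_gamma2 hn⟩
  refine Algebra.adjoin_le ?_
  rintro x (rfl | rfl | rfl | rfl | rfl | rfl)
  · exact a1
  · exact sub_mem (add_mem (pow_mem b2 2) (pow_mem b3 2)) (mul_mem b2 b3)
  · exact sub_mem
      (mul_mem (ofNat_mem _ 2) (add_mem (pow_mem b2 3) (pow_mem b3 3)))
      (mul_mem (ofNat_mem _ 3) (add_mem (mul_mem (pow_mem b2 2) b3) (mul_mem b2 (pow_mem b3 2))))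
  · exact pow_mem g1 2
  · exact pow_mem g2 2
  · exact mul_mem g1 g2

theorem genAlgebra_le_permInvariants : genAlgebra n hn ≤ permInvariants n := by
  obtain ⟨a1, a2, a3, a4, a5⟩ := permAct_swap01 hn
  obtain ⟨b1, b2, b3, b4, b5⟩ := permAct_swap12 hn
  refine Algebra.adjoin_le ?_
  rintro x (rfl | rfl | rfl | rfl | rfl | rfl) <;>
    refine mem_permInvariants_of_swap ?_ ?_ <;>
    simp only [alpha2, alpha3, map_mul, map_sub, map_add, map_pow, map_ofNat, a1, a2, a3, a4, a5,
      b1, b2, b3, b4, b5] <;>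
    ring

end Invariants

section NormalForm

variable {n : ℕ} (hn : 3 ≤ n)

/-- The `n × 3` matrix with upper `3 × 3` block `M` and all other rows zero. -/
def blockPoint (n : ℕ) (M : Matrix (Fin 3) (Fin 3) ℂ) : Fin n × Fin 3 → ℂ :=
  fun p => if h : p.1.val < 3 then M ⟨p.1, h⟩ p.2 else 0

theorem blockPoint_castLE (M : Matrix (Fin 3) (Fin 3) ℂ) (i j : Fin 3) :
    blockPoint n M (Fin.castLE hn i, j) = M i j := by
  simp [blockPoint]

theorem eval_Xe (x : Fin n × Fin 3 → ℂ) (i j : Fin 3) :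
    eval x (Xe n hn i j) = x (Fin.castLE hn i, j) := by
  simp [Xe]

theorem eval_blockPoint_Xe (M : Matrix (Fin 3) (Fin 3) ℂ) (i j : Fin 3) :
    eval (blockPoint n M) (Xe n hn i j) = M i j := by
  rw [eval_Xe, blockPoint_castLE]

/-- A `U_n`-invariant polynomial does not change its value when multiples of the first three rows
are added to rows below them. -/
theorem UInv.eval_rowOp {f : P n} (hf : UInv n f) (c : Fin n → Fin 3 → ℂ)
    (hc : ∀ i k, i ≤ Fin.castLE hn k → c i k = 0) (x : Fin n × Fin 3 → ℂ) :
    eval (fun p => x p + ∑ k : Fin 3, c p.1 k * x (Fin.castLE hn k, p.2)) f = eval x f := by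
  let g : Matrix (Fin n) (Fin n) ℂ := fun s i =>
    (if s = i then 1 else 0) + ∑ k : Fin 3, if s = Fin.castLE hn k then c i k else 0
  have hg : IsUpperUni n g := by
    constructor
    · intro i
      have : ∀ k : Fin 3, (if i = Fin.castLE hn k then c i k else 0) = 0 := by
        intro k
        split_ifs with h
        exacts [hc _ _ h.le, rfl]
      simp [g, this]
    · intro i j hij
      have : ∀ k : Fin 3, (if i = Fin.castLE hn k then c j k else 0) = 0 := by
        intro k
        split_ifs with h
        exacts [hc _ _ (h ▸ hij.le), rfl]
      simp [g, this, hij.ne']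
  conv_rhs => rw [← hf g hg]
  have : (eval x).comp (matAct n g).toRingHom =
      eval (fun p => x p + ∑ k : Fin 3, c p.1 k * x (Fin.castLE hn k, p.2)) := by
    refine ringHom_ext (fun r => by simp [matAct]) fun p => ?_
    simp [matAct, g, add_mul, Finset.sum_add_distrib, Finset.sum_mul, Finset.sum_comm (γ := Fin n)]
  exact (DFunLike.congr_fun this f).symm

/-- A polynomial in `Q` does not change its value when the columns are scaled by factors with
product one. -/
theorem InQ.eval_scale {f : P n} (hf : InQ n f) (t : Fin 3 → ℂ) (ht : t 0 * t 1 * t 2 = 1)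
    (x : Fin n × Fin 3 → ℂ) : eval (fun p => t p.2 * x p) f = eval x f := by
  rw [eval_eq', eval_eq']
  refine Finset.sum_congr rfl fun d hd => ?_
  congr 1
  simp only [mul_pow, Finset.prod_mul_distrib]
  have : ∏ p : Fin n × Fin 3, t p.2 ^ d p = 1 := by
    rw [Fintype.prod_prod_type_right]
    simp only [Finset.prod_pow_eq_pow_sum, hf d hd, Fin.prod_univ_three, ← mul_pow, ht, one_pow]
  rw [this, one_mul]

/-- The normal form of a generic matrix with prescribed values of `α₁, β₂, β₃, γ₁`. -/
def sectionMatrix (y : Fin 4 → ℂ) : Matrix (Fin 3) (Fin 3) ℂ :=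
  !![1, 1, y 0; 0, y 2 / y 0, y 1; 0, 0, y 0 * y 3 / y 2]

/-- The values of `α₁, β₂, β₃, γ₁`. -/
def invariantTuple (n : ℕ) (hn : 3 ≤ n) : Fin 4 → P n :=
  ![alpha1 n hn, beta2 n hn, beta3 n hn, gamma1 n hn]

theorem exists_rowOp (x : Fin n × Fin 3 → ℂ) (h0 : eval x (Xe n hn 0 0) ≠ 0)
    (h1 : eval x (Xe n hn 0 1) ≠ 0) (h2 : eval x (Xe n hn 0 2) ≠ 0)
    (hd : eval x (del n hn 0 1) ≠ 0) (hg : eval x (gamma1 n hn) ≠ 0) (i : Fin n) :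
    ∃ c : Fin 3 → ℂ, (∀ k, i ≤ Fin.castLE hn k → c k = 0) ∧ ∀ j,
      x (i, j) + ∑ k : Fin 3, c k * x (Fin.castLE hn k, j) =
        ![x (Fin.castLE hn 0, 0), x (Fin.castLE hn 0, 1),
          (x (Fin.castLE hn 0, 0) * x (Fin.castLE hn 0, 1))⁻¹] j *
        blockPoint n (sectionMatrix fun l => eval x (invariantTuple n hn l)) (i, j) := by
  by_cases hi : i.val < 3
  · obtain ⟨k, rfl⟩ : ∃ k, i = Fin.castLE hn k := ⟨⟨i, hi⟩, rfl⟩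
    simp only [Fin.castLE_le_castLE_iff, blockPoint_castLE, Fin.sum_univ_three]
    simp only [gamma1_eq, del, map_sub, map_add, map_mul, eval_Xe] at h0 h1 h2 hd hg
    simp only [invariantTuple, sectionMatrix, Matrix.cons_val, alpha1, beta2, beta3, gamma1_eq,
      del, map_sub, map_add, map_mul, eval_Xe]
    obtain ⟨a, ha⟩ : ∃ a : Fin 3 → Fin 3 → ℂ, ∀ k j, x (Fin.castLE hn k, j) = a k j :=
      ⟨_, fun _ _ => rfl⟩
    simp only [ha] at h0 h1 h2 hd hg ⊢
    clear ha hi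
    obtain ⟨D, hD⟩ : ∃ D, D = a 0 0 * a 1 1 - a 1 0 * a 0 1 := ⟨_, rfl⟩
    simp only [← hD] at hd hg ⊢
    fin_cases k
    · refine ⟨0, fun _ _ => rfl, fun j => ?_⟩
      fin_cases j <;> simp
      field_simp
    · refine ⟨![-(a 1 0 / a 0 0), 0, 0], fun k hk => ?_, fun j => ?_⟩
      · fin_cases k <;> simp at hk ⊢
      · fin_cases j <;> simp <;> field_simp <;> subst hD <;> ring
    · refine ⟨![-((a 2 0 * a 1 1 - a 2 1 * a 1 0) / D),
        -((a 0 0 * a 2 1 - a 0 1 * a 2 0) / D), 0],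
        fun k hk => ?_, fun j => ?_⟩
      · fin_cases k <;> simp at hk ⊢
      · fin_cases j <;> simp <;> field_simp <;> subst hD <;> ring
  · let M : Matrix (Fin 3) (Fin 3) ℂ := fun k j => x (Fin.castLE hn k, j)
    have hM : IsUnit M.det := by
      rw [isUnit_iff_ne_zero]
      convert hg
      rw [gamma1, RingHom.map_det]
      congr 1
      ext k j
      simp [M, eval_Xe]
    refine ⟨-Matrix.vecMul (fun j => x (i, j)) M⁻¹, fun k hk => ?_, fun j => ?_⟩
    · exact absurd (lt_of_le_of_lt (Fin.le_def.mp hk) k.2) hi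
    · have h : Matrix.vecMul (Matrix.vecMul (fun j => x (i, j)) M⁻¹) M = fun j => x (i, j) := by
        rw [Matrix.vecMul_vecMul, Matrix.nonsing_inv_mul _ hM, Matrix.vecMul_one]
      have := congrFun h j
      simp only [Matrix.vecMul, dotProduct, M] at this
      simp [blockPoint, hi, Matrix.vecMul, dotProduct, this, M]

theorem eval_eq_eval_section {f : P n} (hf : f ∈ unipotentInvariants n) (x : Fin n × Fin 3 → ℂ)
    (h0 : eval x (Xe n hn 0 0) ≠ 0) (h1 : eval x (Xe n hn 0 1) ≠ 0)
    (h2 : eval x (Xe n hn 0 2) ≠ 0) (hd : eval x (del n hn 0 1) ≠ 0)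
    (hg : eval x (gamma1 n hn) ≠ 0) :
    eval x f =
      eval (blockPoint n (sectionMatrix fun l => eval x (invariantTuple n hn l))) f := by
  choose c hc hx using exists_rowOp hn x h0 h1 h2 hd hg
  rw [← hf.2.eval_rowOp hn c hc x]
  simp only [hx]
  rw [eval_Xe] at h0 h1
  refine hf.1.eval_scale _ ?_ _
  simp only [Matrix.cons_val]
  field_simp

/-- Values of the basic invariants at the normal form. -/
theorem eval_section_invariantTuple {y : Fin 4 → ℂ} (h0 : y 0 ≠ 0) (h2 : y 2 ≠ 0) (l : Fin 4) :
    eval (blockPoint n (sectionMatrix y)) (invariantTuple n hn l) = y l := by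
  fin_cases l <;>
    simp [invariantTuple, alpha1, beta2, beta3, gamma1_eq, del, eval_blockPoint_Xe,
      sectionMatrix] <;>
    field_simp

theorem eval_aeval {σ τ : Type*} (x : τ → ℂ) (u : σ → MvPolynomial τ ℂ) (G : MvPolynomial σ ℂ) :
    eval x (aeval u G) = eval (fun l => eval x (u l)) G := by
  have : (eval x).comp (aeval u).toRingHom = eval (fun l => eval x (u l)) :=
    ringHom_ext (fun r => by simp) fun l => by simp
  exact DFunLike.congr_fun this G

/-- Two polynomials agreeing wherever a nonzero polynomial does not vanish are equal. -/
theorem eq_of_eval_eq_of_ne_zero {σ : Type*} {D F G : MvPolynomial σ ℂ} (hD : D ≠ 0)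
    (h : ∀ x, eval x D ≠ 0 → eval x F = eval x G) : F = G := by
  refine mul_left_cancel₀ hD (MvPolynomial.funext fun x => ?_)
  rw [map_mul, map_mul]
  by_cases hx : eval x D = 0
  · rw [hx, zero_mul, zero_mul]
  · rw [h x hx]

/-- Substituting fractions with a common denominator into a polynomial and clearing the
denominator yields a polynomial. -/
theorem exists_clear_denominator {σ τ : Type*} (f : MvPolynomial σ ℂ) (D : MvPolynomial τ ℂ)
    (A : σ → MvPolynomial τ ℂ) : ∃ (N : ℕ) (G : MvPolynomial τ ℂ), ∀ (y : τ → ℂ) (x : σ → ℂ),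
      (∀ v, eval y D * x v = eval y (A v)) → eval y D ^ N * eval x f = eval y G := by
  induction f using MvPolynomial.induction_on with
  | C a => exact ⟨0, C a, fun y x _ => by simp⟩
  | add p q hp hq =>
    obtain ⟨N, G, hG⟩ := hp
    obtain ⟨M, H, hH⟩ := hq
    refine ⟨N + M, D ^ M * G + D ^ N * H, fun y x h => ?_⟩
    simp only [map_add, map_mul, map_pow, ← hG y x h, ← hH y x h]
    ring
  | mul_X p v hp =>
    obtain ⟨N, G, hG⟩ := hp
    refine ⟨N + 1, G * A v, fun y x h => ?_⟩
    simp only [map_mul, ← hG y x h, ← h v, eval_X]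
    ring

theorem exists_section_polynomial (hn : 3 ≤ n) (f : P n) :
    ∃ (N : ℕ) (G : MvPolynomial (Fin 4) ℂ), ∀ y : Fin 4 → ℂ, y 0 ≠ 0 → y 2 ≠ 0 →
      (y 0 * y 2) ^ N * eval (blockPoint n (sectionMatrix y)) f = eval y G := by
  let M : Matrix (Fin 3) (Fin 3) (MvPolynomial (Fin 4) ℂ) :=
    !![X 0 * X 2, X 0 * X 2, X 0 ^ 2 * X 2; 0, X 2 ^ 2, X 0 * X 1 * X 2; 0, 0, X 0 ^ 2 * X 3]
  obtain ⟨N, G, h⟩ := exists_clear_denominator f (X 0 * X 2 : MvPolynomial (Fin 4) ℂ)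
    (fun p => if h : p.1.val < 3 then M ⟨p.1, h⟩ p.2 else 0)
  refine ⟨N, G, fun y h0 h2 => ?_⟩
  rw [← h y (blockPoint n (sectionMatrix y)), map_mul, eval_X, eval_X]
  rintro ⟨i, j⟩
  by_cases hi : i.val < 3
  · obtain ⟨k, rfl⟩ : ∃ k, i = Fin.castLE hn k := ⟨⟨i, hi⟩, rfl⟩
    rw [blockPoint_castLE]
    fin_cases k <;> fin_cases j <;> simp [M, sectionMatrix] <;> field_simp
  · simp [blockPoint, hi]

theorem eval_permAct (σ : Equiv.Perm (Fin 3)) (f : P n) (x : Fin n × Fin 3 → ℂ) :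
    eval x (permAct n σ f) = eval (fun p => x (p.1, σ p.2)) f := by
  have : (eval x).comp (permAct n σ).toRingHom = eval (fun p => x (p.1, σ p.2)) :=
    ringHom_ext (fun r => by simp [permAct]) fun p => by simp [permAct]
  exact DFunLike.congr_fun this f

theorem eval_section_swap (hn : 3 ≤ n) {f : P n} (hf : f ∈ unipotentInvariants n) (hp : f ∈ permInvariants n)
    {y : Fin 4 → ℂ} (hy : ∀ l, y l ≠ 0) :
    eval (blockPoint n (sectionMatrix y)) f =
      eval (blockPoint n (sectionMatrix ![y 0, y 2, y 1, - y 3])) f := by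
  obtain ⟨b1, b2, b3, b4, -⟩ := permAct_swap12 hn
  have hs := eval_section_invariantTuple hn (hy 0) (hy 2)
  have e (q : P n) := eval_permAct (Equiv.swap 1 2) q (blockPoint n (sectionMatrix y))
  have ht : (fun l => eval (fun p => blockPoint n (sectionMatrix y) (p.1, Equiv.swap 1 2 p.2))
      (invariantTuple n hn l)) = ![y 0, y 2, y 1, - y 3] := by
    funext l
    rw [← e]
    have h0 := hs 0
    have h1 := hs 1
    have h2 := hs 2
    have h3 := hs 3
    simp only [invariantTuple, Matrix.cons_val] at h0 h1 h2 h3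
    fin_cases l <;> simp [invariantTuple, b1, b2, b3, b4, h0, h1, h2, h3]
  conv_lhs => rw [← hp (Equiv.swap 1 2), e]
  rw [eval_eq_eval_section hn hf, ht]
  · rw [← e, permAct_Xe, swap_values.2.2.2.1, eval_blockPoint_Xe]
    simp [sectionMatrix]
  · rw [← e, permAct_Xe, swap_values.2.2.2.2.1, eval_blockPoint_Xe]
    simpa [sectionMatrix] using hy 0
  · rw [← e, permAct_Xe, swap_values.2.2.2.2.2, eval_blockPoint_Xe]
    simp [sectionMatrix]
  · rw [← e, del, map_sub, map_mul, map_mul]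
    simp only [permAct_Xe, swap_values.2.2.2.1, swap_values.2.2.2.2.1, map_sub, map_mul,
      eval_blockPoint_Xe]
    simpa [sectionMatrix] using hy 1
  · have := congrFun ht 3
    simp only [invariantTuple, Matrix.cons_val] at this
    rw [this]
    exact neg_ne_zero.mpr (hy 3)

/-- After multiplication by a power of `α₁`, an invariant becomes a polynomial in
`α₁, β₂, β₃, γ₁`. -/
theorem exists_alpha1_pow_mul {f : P n} (hf : f ∈ unipotentInvariants n)
    (hp : f ∈ permInvariants n) : ∃ (N : ℕ) (H : MvPolynomial (Fin 4) ℂ),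
      alpha1 n hn ^ N * f = aeval (invariantTuple n hn) H := by
  obtain ⟨N, G, hG⟩ := exists_section_polynomial hn f
  have hX (y : Fin 4 → ℂ) (h : eval y (X 0 * X 1 * X 2 * X 3) ≠ 0) : ∀ l, y l ≠ 0 := by
    simpa [Fin.forall_fin_succ, and_assoc] using h
  have hD : (X 0 * X 1 * X 2 * X 3 : MvPolynomial (Fin 4) ℂ) ≠ 0 := by simp
  have h1 : X 1 ^ N * G = X 2 ^ N * aeval ![X 0, X 2, X 1, - X 3] G := by
    refine eq_of_eval_eq_of_ne_zero hD fun y hy => ?_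
    replace hy := hX y hy
    have e1 := hG y (hy 0) (hy 2)
    have e2 := hG ![y 0, y 2, y 1, - y 3] (hy 0) (hy 1)
    rw [← eval_section_swap hn hf hp hy] at e2
    have e3 : eval y (aeval ![X 0, X 2, X 1, - X 3] G) = eval ![y 0, y 2, y 1, - y 3] G := by
      rw [eval_aeval]
      congr 2
      funext l
      fin_cases l <;> simp
    rw [map_mul, map_mul, e3, ← e1, ← e2]
    simp [mul_pow]
    ring
  obtain ⟨H, rfl⟩ : X 2 ^ N ∣ G := by
    refine X_prime.pow_dvd_of_dvd_mul_left N (a := X 1 ^ N) ?_ ⟨_, h1⟩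
    intro h
    exact absurd (X_dvd_X.mp (X_prime.dvd_of_dvd_pow h)) (by decide)
  refine ⟨N, H, ?_⟩
  have hD' : Xe n hn 0 0 * Xe n hn 0 1 * Xe n hn 0 2 * del n hn 0 1 * gamma1 n hn ≠ 0 := by
    intro h
    have := congrArg (eval (blockPoint n (sectionMatrix 1))) h
    simp [gamma1_eq, del, eval_blockPoint_Xe, sectionMatrix] at this
  refine eq_of_eval_eq_of_ne_zero hD' fun x hx => ?_
  simp only [map_mul, mul_ne_zero_iff] at hx
  obtain ⟨⟨⟨⟨h0, h1⟩, h2⟩, hd⟩, hg⟩ := hx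
  have ha : eval x (alpha1 n hn) ≠ 0 := by simp [alpha1, h0, h1, h2]
  have hb : eval x (beta3 n hn) ≠ 0 := by simp [beta3, h2, hd]
  have := hG (fun l => eval x (invariantTuple n hn l)) ha hb
  rw [← eval_eq_eval_section hn hf x h0 h1 h2 hd hg, map_mul, map_pow, eval_X, mul_pow,
    mul_right_comm, mul_comm] at this
  have h3 := mul_left_cancel₀ (pow_ne_zero N hb) this
  rw [map_mul, map_pow, eval_aeval]
  exact h3

end NormalForm

section Saturation

variable {n : ℕ} (hn : 3 ≤ n)

/-- The generators `α₁, β₂, β₃, γ₁, γ₂` of the algebra of `U_n`-invariants in `Q`. -/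
def invariantGens (n : ℕ) (hn : 3 ≤ n) : Fin 5 → P n :=
  ![alpha1 n hn, beta2 n hn, beta3 n hn, gamma1 n hn, gamma2 n hn]

theorem dvd_aeval_sub_aeval {σ A : Type*} [CommRing A] [Algebra ℂ A] {L : A} {u v : σ → A}
    (h : ∀ i, L ∣ u i - v i) (G : MvPolynomial σ ℂ) : L ∣ aeval u G - aeval v G := by
  induction G using MvPolynomial.induction_on with
  | C a => simp
  | add p q hp hq =>
    rw [map_add, map_add, add_sub_add_comm]
    exact dvd_add hp hq
  | mul_X p i hp =>
    have : aeval u (p * X i) - aeval v (p * X i) =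
        (aeval u p - aeval v p) * u i + aeval v p * (u i - v i) := by
      simp only [map_mul, aeval_X]
      ring
    rw [this]
    exact dvd_add (dvd_mul_of_dvd_left hp _) (dvd_mul_of_dvd_right (h i) _)

theorem dvd_aeval_of_aeval_eq_zero {σ A : Type*} [CommRing A] [Algebra ℂ A] {L : A} {u v : σ → A}
    {G : MvPolynomial σ ℂ} (e : aeval v G = 0) (h : ∀ i, L ∣ u i - v i) : L ∣ aeval u G := by
  have := dvd_aeval_sub_aeval h G
  rwa [e, sub_zero] at this

/-- A polynomial relation `α₁ h = G(α₁, β₂, β₃, γ₁, γ₂)` specialises at a matrix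
where `α₁` vanishes. -/
theorem eval_eq_zero_of_alpha1_mul_eq {h : P n} {G : MvPolynomial (Fin 5) ℂ}
    (hG : alpha1 n hn * h = aeval (invariantGens n hn) G) (M : Matrix (Fin 3) (Fin 3) ℂ)
    (hM : M 0 0 * M 0 1 * M 0 2 = 0) {y : Fin 5 → ℂ}
    (hy : ∀ l, eval (blockPoint n M) (invariantGens n hn l) = y l) : eval y G = 0 := by
  have := congrArg (eval (blockPoint n M)) hG
  rw [eval_aeval, funext hy, map_mul] at this
  rw [← this]
  simp [alpha1, eval_blockPoint_Xe, hM]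

theorem relation_divisibility {h : P n} {G : MvPolynomial (Fin 5) ℂ}
    (hG : alpha1 n hn * h = aeval (invariantGens n hn) G) :
    (X 1 - X 2) * X 1 * X 2 ∣
      aeval (![0, X 1, X 2, X 3, X 4] : Fin 5 → MvPolynomial (Fin 5) ℂ) G := by
  have hz (M : (Fin 5 → ℂ) → Matrix (Fin 3) (Fin 3) ℂ) (k : Fin 5) (hk : k = 1 ∨ k = 2)
      (u : Fin 5 → MvPolynomial (Fin 5) ℂ)
      (hM : ∀ y, M y 0 0 * M y 0 1 * M y 0 2 = 0)
      (hy : ∀ y : Fin 5 → ℂ, y k ≠ 0 → y 4 ≠ 0 → ∀ l,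
        eval (blockPoint n (M y)) (invariantGens n hn l) = eval y (u l)) : aeval u G = 0 := by
    refine eq_of_eval_eq_of_ne_zero (D := X k * X 4) (by simp) fun y hD => ?_
    rw [eval_aeval, map_zero]
    simp only [map_mul, eval_X, mul_ne_zero_iff] at hD
    exact eval_eq_zero_of_alpha1_mul_eq hn hG (M y) (hM y) (hy y hD.1 hD.2)
  have d0 : X 1 - X 2 ∣
      aeval (![0, X 1, X 2, X 3, X 4] : Fin 5 → MvPolynomial (Fin 5) ℂ) G := by
    have e : aeval (![0, X 2, X 2, X 3, X 4] : Fin 5 → MvPolynomial (Fin 5) ℂ) G = 0 := by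
      refine hz (fun y => !![0, 1, 1; -y 2, 0, y 4 / y 2 ^ 2; 0, 0, y 3 / y 2]) 2 (by simp) _
        (fun y => by simp) fun y h1 h2 l => ?_
      fin_cases l <;> simp [invariantGens, alpha1, beta2, beta3, gamma1_eq, gamma2, del,
        eval_blockPoint_Xe] <;> field_simp
    refine dvd_aeval_of_aeval_eq_zero e fun i => ?_
    fin_cases i <;> simp
  have d1 : X 1 ∣
      aeval (![0, X 1, X 2, X 3, X 4] : Fin 5 → MvPolynomial (Fin 5) ℂ) G := by
    have e : aeval (![0, 0, X 2, X 3, X 4] : Fin 5 → MvPolynomial (Fin 5) ℂ) G = 0 := by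
      refine hz (fun y => !![1, 0, 1; 0, y 2, -(y 4 / y 2 ^ 2); 0, 0, y 3 / y 2]) 2 (by simp) _
        (fun y => by simp) fun y h1 h2 l => ?_
      fin_cases l <;> simp [invariantGens, alpha1, beta2, beta3, gamma1_eq, gamma2, del,
        eval_blockPoint_Xe] <;> field_simp
    refine dvd_aeval_of_aeval_eq_zero e fun i => ?_
    fin_cases i <;> simp
  have d2 : X 2 ∣
      aeval (![0, X 1, X 2, X 3, X 4] : Fin 5 → MvPolynomial (Fin 5) ℂ) G := by
    have e : aeval (![0, X 1, 0, X 3, X 4] : Fin 5 → MvPolynomial (Fin 5) ℂ) G = 0 := by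
      refine hz (fun y => !![1, 1, 0; 0, y 4 / y 1 ^ 2, y 1; 0, 0, y 3 * y 1 ^ 2 / y 4]) 1
        (by simp) _ (fun y => by simp) fun y h1 h2 l => ?_
      fin_cases l <;> simp [invariantGens, alpha1, beta2, beta3, gamma1_eq, gamma2, del,
        eval_blockPoint_Xe] <;> field_simp
    refine dvd_aeval_of_aeval_eq_zero e fun i => ?_
    fin_cases i <;> simp
  have n12 : ¬ (X 1 : MvPolynomial (Fin 5) ℂ) ∣ X 1 - X 2 := by
    rw [dvd_sub_right dvd_rfl, X_dvd_X]
    decide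
  have n21 : ¬ (X 2 : MvPolynomial (Fin 5) ℂ) ∣ (X 1 - X 2) * X 1 := by
    intro h
    rcases X_prime.dvd_or_dvd h with h | h
    · rw [dvd_sub_left dvd_rfl, X_dvd_X] at h
      exact absurd h (by decide)
    · exact absurd (X_dvd_X.mp h) (by decide)
  obtain ⟨A, hA⟩ := d0
  rw [hA] at d1 d2 ⊢
  obtain ⟨B, rfl⟩ := (X_prime.dvd_or_dvd d1).resolve_left n12
  rw [← mul_assoc] at d2 ⊢
  obtain ⟨E, rfl⟩ := (X_prime.dvd_or_dvd d2).resolve_left n21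
  rw [← mul_assoc]
  exact dvd_mul_right _ _

theorem beta_relation : (beta2 n hn - beta3 n hn) * beta2 n hn * beta3 n hn =
    alpha1 n hn * gamma2 n hn := by
  simp only [beta2, beta3, alpha1, gamma2, del]
  ring

theorem mem_range_of_alpha1_mul {h : P n}
    (hh : alpha1 n hn * h ∈ (aeval (R := ℂ) (invariantGens n hn)).range) :
    h ∈ (aeval (R := ℂ) (invariantGens n hn)).range := by
  obtain ⟨G, hG⟩ := hh
  replace hG : alpha1 n hn * h = aeval (invariantGens n hn) G := hG.symm
  obtain ⟨B, hB⟩ := relation_divisibility hn hG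
  obtain ⟨A, hA⟩ : X 0 ∣ aeval (X : Fin 5 → MvPolynomial (Fin 5) ℂ) G -
      aeval (![0, X 1, X 2, X 3, X 4] : Fin 5 → MvPolynomial (Fin 5) ℂ) G := by
    refine dvd_aeval_sub_aeval (fun i => ?_) G
    fin_cases i <;> simp
  have ha : alpha1 n hn ≠ 0 := by simp [alpha1, Xe]
  refine ⟨A + X 4 * B, mul_left_cancel₀ ha ?_⟩
  rw [hB, aeval_X_left_apply, sub_eq_iff_eq_add] at hA
  have e := beta_relation hn
  rw [hG, hA]
  change alpha1 n hn * aeval (invariantGens n hn) _ = _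
  simp only [map_add, map_mul, map_sub, aeval_X]
  simp only [invariantGens, Matrix.cons_val] at e ⊢
  rw [e]
  ring

theorem mem_range_of_invariant {f : P n} (hf : f ∈ unipotentInvariants n)
    (hp : f ∈ permInvariants n) : f ∈ (aeval (R := ℂ) (invariantGens n hn)).range := by
  obtain ⟨N, H, hH⟩ := exists_alpha1_pow_mul hn hf hp
  have : alpha1 n hn ^ N * f ∈ (aeval (R := ℂ) (invariantGens n hn)).range := by
    refine ⟨rename Fin.castSucc H, ?_⟩
    rw [hH]
    change aeval (invariantGens n hn) _ = _
    rw [aeval_rename]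
    congr 2
    funext l
    fin_cases l <;> rfl
  clear hH
  induction N with
  | zero => simpa using this
  | succ N ih => exact ih (mem_range_of_alpha1_mul hn (by rwa [← mul_assoc, ← pow_succ']))

end Saturation

section Averaging

variable {n : ℕ} (hn : 3 ≤ n)

/-- The first of the three linear forms `β₂ + β₃`, `β₂ - 2β₃`, `β₃ - 2β₂` permuted by `S₃`. -/
def linP (n : ℕ) (hn : 3 ≤ n) : P n := beta2 n hn + beta3 n hn

/-- The second of the three linear forms `β₂ + β₃`, `β₂ - 2β₃`, `β₃ - 2β₂` permuted by `S₃`. -/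
def linQ (n : ℕ) (hn : 3 ≤ n) : P n := beta2 n hn - 2 * beta3 n hn

theorem alpha2_eq : 3 * alpha2 n hn =
    linP n hn ^ 2 + linP n hn * linQ n hn + linQ n hn ^ 2 := by
  simp only [alpha2, linP, linQ]
  ring

theorem alpha3_eq : alpha3 n hn = linP n hn * linQ n hn * (linP n hn + linQ n hn) := by
  simp only [alpha3, linP, linQ]
  ring

theorem alternating_eq : (linP n hn - linQ n hn) * (2 * linP n hn + linQ n hn) *
    (linP n hn + 2 * linQ n hn) = 27 * (alpha1 n hn * gamma2 n hn) := by
  rw [← beta_relation]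
  simp only [linP, linQ]
  ring

/-- `u` is a combination of `1, p, p², q, pq, p²q` with coefficients invariant under `S₃`, where
`p` and `q` are `linP` and `linQ`. -/
def IsCoinvariantSum (n : ℕ) (hn : 3 ≤ n) (u : P n) : Prop :=
  ∃ a b c d e f : genAlgebra n hn, u = a + b * linP n hn + c * linP n hn ^ 2 + d * linQ n hn +
    e * (linP n hn * linQ n hn) + f * (linP n hn ^ 2 * linQ n hn)

variable {hn}

theorem IsCoinvariantSum.add {u v : P n} (hu : IsCoinvariantSum n hn u)
    (hv : IsCoinvariantSum n hn v) : IsCoinvariantSum n hn (u + v) := by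
  obtain ⟨a, b, c, d, e, f, rfl⟩ := hu
  obtain ⟨a', b', c', d', e', f', rfl⟩ := hv
  refine ⟨a + a', b + b', c + c', d + d', e + e', f + f', ?_⟩
  push_cast
  ring

theorem IsCoinvariantSum.smul {u : P n} (s : genAlgebra n hn) (hu : IsCoinvariantSum n hn u) :
    IsCoinvariantSum n hn (s * u) := by
  obtain ⟨a, b, c, d, e, f, rfl⟩ := hu
  refine ⟨s * a, s * b, s * c, s * d, s * e, s * f, ?_⟩
  push_cast
  ring

theorem IsCoinvariantSum.coe (s : genAlgebra n hn) : IsCoinvariantSum n hn s :=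
  ⟨s, 0, 0, 0, 0, 0, by simp⟩

theorem alpha2_mem : alpha2 n hn ∈ genAlgebra n hn := Algebra.subset_adjoin (by simp)

theorem alpha3_mem : alpha3 n hn ∈ genAlgebra n hn := Algebra.subset_adjoin (by simp)

theorem coe_genAlgebra_three : ((3 : genAlgebra n hn) : P n) = 3 := rfl

theorem IsCoinvariantSum.mul_linP {u : P n} (hu : IsCoinvariantSum n hn u) :
    IsCoinvariantSum n hn (u * linP n hn) := by
  obtain ⟨a, b, c, d, e, f, rfl⟩ := hu
  refine ⟨-c * ⟨_, alpha3_mem⟩, a + 3 * c * ⟨_, alpha2_mem⟩, b,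
    -f * ⟨_, alpha3_mem⟩, d + 3 * f * ⟨_, alpha2_mem⟩, e, ?_⟩
  push_cast [coe_genAlgebra_three]
  linear_combination (-(c : P n) - f * linQ n hn) *
    (linP n hn * alpha2_eq hn - alpha3_eq hn)

theorem IsCoinvariantSum.mul_linQ {u : P n} (hu : IsCoinvariantSum n hn u) :
    IsCoinvariantSum n hn (u * linQ n hn) := by
  obtain ⟨a, b, c, d, e, f, rfl⟩ := hu
  refine ⟨3 * d * ⟨_, alpha2_mem⟩ + e * ⟨_, alpha3_mem⟩, f * ⟨_, alpha3_mem⟩, - d,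
    a + f * ⟨_, alpha3_mem⟩, b - d - 3 * f * ⟨_, alpha2_mem⟩, c - e, ?_⟩
  push_cast [coe_genAlgebra_three]
  linear_combination (-(d : P n) + f * linP n hn * linQ n hn) * alpha2_eq hn -
    (e + f * (linP n hn + linQ n hn)) * alpha3_eq hn

theorem IsCoinvariantSum.mul_C {u : P n} (r : ℂ) (hu : IsCoinvariantSum n hn u) :
    IsCoinvariantSum n hn (u * C r) := by
  rw [mul_comm]
  exact hu.smul (algebraMap ℂ (genAlgebra n hn) r)

theorem IsCoinvariantSum.mul_beta2 {u : P n} (hu : IsCoinvariantSum n hn u) :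
    IsCoinvariantSum n hn (u * beta2 n hn) := by
  have h : u * beta2 n hn = u * linP n hn * C (2 / 3) + u * linQ n hn * C (1 / 3) := by
    have h2 : (C (2 / 3) : P n) = 2 * C (1 / 3) := by
      rw [← map_ofNat C 2, ← C_mul]
      norm_num
    have h3 : (3 * C (1 / 3) : P n) = 1 := by
      rw [← map_ofNat C 3, ← C_mul]
      norm_num
    rw [h2, linP, linQ]
    linear_combination -u * beta2 n hn * h3
  rw [h]
  exact (hu.mul_linP.mul_C _).add (hu.mul_linQ.mul_C _)

theorem IsCoinvariantSum.mul_beta3 {u : P n} (hu : IsCoinvariantSum n hn u) :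
    IsCoinvariantSum n hn (u * beta3 n hn) := by
  have h : u * beta3 n hn = u * linP n hn + u * beta2 n hn * C (-1) := by
    rw [C_neg, C_1, linP]
    ring
  rw [h]
  exact hu.mul_linP.add (hu.mul_beta2.mul_C _)

/-- Every polynomial in `α₁, β₂, β₃, γ₁, γ₂` is of the form `u + γ₁ v + γ₂ w`. -/
theorem exists_coinvariantSum {f : P n}
    (hf : f ∈ (aeval (R := ℂ) (invariantGens n hn)).range) :
    ∃ u v w : P n, IsCoinvariantSum n hn u ∧ IsCoinvariantSum n hn v ∧
      IsCoinvariantSum n hn w ∧ f = u + gamma1 n hn * v + gamma2 n hn * w := by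
  obtain ⟨G, rfl⟩ := hf
  change ∃ u v w : P n, _ ∧ _ ∧ _ ∧ aeval (invariantGens n hn) G = _
  have hz : IsCoinvariantSum n hn 0 := .coe 0
  have ha : alpha1 n hn ∈ genAlgebra n hn := Algebra.subset_adjoin (by simp)
  have h11 : gamma1 n hn ^ 2 ∈ genAlgebra n hn := Algebra.subset_adjoin (by simp)
  have h22 : gamma2 n hn ^ 2 ∈ genAlgebra n hn := Algebra.subset_adjoin (by simp)
  have h12 : gamma1 n hn * gamma2 n hn ∈ genAlgebra n hn := Algebra.subset_adjoin (by simp)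
  induction G using MvPolynomial.induction_on with
  | C r =>
    refine ⟨C r, 0, 0, .coe (algebraMap ℂ (genAlgebra n hn) r), hz, hz, ?_⟩
    rw [aeval_C, algebraMap_eq]
    ring
  | add p q hp hq =>
    obtain ⟨u, v, w, hu, hv, hw, h⟩ := hp
    obtain ⟨u', v', w', hu', hv', hw', h'⟩ := hq
    refine ⟨u + u', v + v', w + w', hu.add hu', hv.add hv', hw.add hw', ?_⟩
    rw [map_add, h, h']
    ring
  | mul_X p i hp =>
    obtain ⟨u, v, w, hu, hv, hw, h⟩ := hp
    rw [map_mul, h, aeval_X]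
    fin_cases i <;> simp only [invariantGens, Matrix.cons_val, Fin.reduceFinMk, Fin.zero_eta,
      Fin.mk_one]
    · exact ⟨_, _, _, hu.smul ⟨_, ha⟩, hv.smul ⟨_, ha⟩, hw.smul ⟨_, ha⟩, by ring⟩
    · exact ⟨_, _, _, hu.mul_beta2, hv.mul_beta2, hw.mul_beta2, by ring⟩
    · exact ⟨_, _, _, hu.mul_beta3, hv.mul_beta3, hw.mul_beta3, by ring⟩
    · exact ⟨_, _, _, (hv.smul ⟨_, h11⟩).add (hw.smul ⟨_, h12⟩), hu, hz, by ring⟩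
    · exact ⟨_, _, _, (hv.smul ⟨_, h12⟩).add (hw.smul ⟨_, h22⟩), hz, hu, by ring⟩

theorem mem_genAlgebra_of_coinvariantSum {f u v w : P n} (hp : f ∈ permInvariants n)
    (hu : IsCoinvariantSum n hn u) (hv : IsCoinvariantSum n hn v)
    (hw : IsCoinvariantSum n hn w) (hf : f = u + gamma1 n hn * v + gamma2 n hn * w) :
    f ∈ genAlgebra n hn := by
  obtain ⟨a, b, c, d, e, k, rfl⟩ := hu
  obtain ⟨a', b', c', d', e', k', rfl⟩ := hv
  obtain ⟨a'', b'', c'', d'', e'', k'', rfl⟩ := hw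
  have hfix (σ : Equiv.Perm (Fin 3)) (s : genAlgebra n hn) : permAct n σ s = s :=
    genAlgebra_le_permInvariants hn s.2 σ
  obtain ⟨-, s2, s3, s4, s5⟩ := permAct_swap01 hn
  obtain ⟨-, t2, t3, t4, t5⟩ := permAct_swap12 hn
  have sp : permAct n (Equiv.swap 0 1) (linP n hn) = linQ n hn := by
    rw [linP, linQ, map_add, s2, s3]
    ring
  have sq : permAct n (Equiv.swap 0 1) (linQ n hn) = linP n hn := by
    rw [linP, linQ, map_sub, map_mul, map_ofNat, s2, s3]
    ring
  have tp : permAct n (Equiv.swap 1 2) (linP n hn) = linP n hn := by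
    rw [linP, map_add, t2, t3]
    ring
  have tq : permAct n (Equiv.swap 1 2) (linQ n hn) = - linP n hn - linQ n hn := by
    rw [linP, linQ, map_sub, map_mul, map_ofNat, t2, t3]
    ring
  have es := congrArg (permAct n (Equiv.swap 0 1)) hf
  have et := congrArg (permAct n (Equiv.swap 1 2)) hf
  rw [hp] at es et
  simp only [map_add, map_mul, map_pow, hfix, sp, sq, s4, s5] at es
  simp only [map_add, map_mul, map_pow, hfix, tp, tq, t4, t5] at et
  have est := congrArg (permAct n (Equiv.swap 0 1)) et
  have ets := congrArg (permAct n (Equiv.swap 1 2)) es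
  rw [hp] at est ets
  simp only [map_add, map_sub, map_neg, map_mul, map_pow, hfix, sp, sq, s4, s5] at est
  simp only [map_add, map_neg, map_mul, map_pow, hfix, tp, tq, t4, t5] at ets
  have ests := congrArg (permAct n (Equiv.swap 0 1)) ets
  rw [hp] at ests
  simp only [map_add, map_sub, map_neg, map_mul, map_pow, hfix, sp, sq, s4, s5] at ests
  have key : 6 * f = 6 * a + 12 * (c * alpha2 n hn) - 6 * (e * alpha2 n hn) +
      3 * (k * alpha3 n hn) + 27 * (alpha1 n hn * (gamma1 n hn * gamma2 n hn) * k') +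
      27 * (alpha1 n hn * gamma2 n hn ^ 2 * k'') := by
    linear_combination hf + es + et + est + ets + ests +
      (-4 * (c : P n) + 2 * e) * alpha2_eq hn - 3 * (k : P n) * alpha3_eq hn +
      (gamma1 n hn * k' + gamma2 n hn * k'') * alternating_eq hn
  have ha : alpha1 n hn ∈ genAlgebra n hn := Algebra.subset_adjoin (by simp)
  have h22 : gamma2 n hn ^ 2 ∈ genAlgebra n hn := Algebra.subset_adjoin (by simp)
  have h12 : gamma1 n hn * gamma2 n hn ∈ genAlgebra n hn := Algebra.subset_adjoin (by simp)
  have h6 : f = (1 / 6 : ℂ) • (6 * f) := by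
    rw [smul_eq_C_mul, ← mul_assoc, ← map_ofNat C 6, ← C_mul]
    norm_num
  rw [h6]
  refine Subalgebra.smul_mem _ ?_ _
  rw [key]
  have hnum (m : ℕ) [m.AtLeastTwo] : (OfNat.ofNat m : P n) ∈ genAlgebra n hn := ofNat_mem _ m
  exact add_mem (add_mem (add_mem (sub_mem (add_mem (mul_mem (hnum 6) a.2)
    (mul_mem (hnum 12) (mul_mem c.2 alpha2_mem))) (mul_mem (hnum 6) (mul_mem e.2 alpha2_mem)))
    (mul_mem (hnum 3) (mul_mem k.2 alpha3_mem)))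
    (mul_mem (hnum 27) (mul_mem (mul_mem ha h12) k'.2)))
    (mul_mem (hnum 27) (mul_mem (mul_mem ha h22) k''.2))

end Averaging

theorem coe_genAlgebra_eq (n : ℕ) (hn : 3 ≤ n) : (genAlgebra n hn : Set (P n)) =
    {f : P n | InQ n f ∧ UInv n f ∧ ∀ σ : Equiv.Perm (Fin 3), permAct n σ f = f} := by
  ext f
  constructor
  · intro hf
    obtain ⟨h1, h2⟩ := genAlgebra_le_unipotentInvariants hn hf
    exact ⟨h1, h2, genAlgebra_le_permInvariants hn hf⟩
  · rintro ⟨h1, h2, h3⟩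
    obtain ⟨u, v, w, hu, hv, hw, h⟩ :=
      exists_coinvariantSum (mem_range_of_invariant hn ⟨h1, h2⟩ h3)
    exact mem_genAlgebra_of_coinvariantSum h3 hu hv hw h

/-- The algebra is linearly spanned by the monomials in its generators. -/
theorem span_Sinv_eq (n : ℕ) (hn : 3 ≤ n) : Submodule.span ℂ (Set.range (Sinv n hn)) =
    Subalgebra.toSubmodule (genAlgebra n hn) := by
  apply le_antisymm
  · rw [Submodule.span_le]
    rintro _ ⟨⟨a, b, c, d, e, f⟩, rfl⟩
    have h (x : P n) (hx : x ∈ ({alpha1 n hn, alpha2 n hn, alpha3 n hn, gamma1 n hn ^ 2,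
        gamma2 n hn ^ 2, gamma1 n hn * gamma2 n hn} : Set (P n))) (k : ℕ) :
        x ^ k ∈ genAlgebra n hn := pow_mem (Algebra.subset_adjoin hx) k
    change Sinv n hn (a, b, c, d, e, f) ∈ genAlgebra n hn
    exact mul_mem (mul_mem (mul_mem (mul_mem (mul_mem (h _ (by simp) a) (h _ (by simp) b))
      (h _ (by simp) c)) (h _ (by simp) d)) (h _ (by simp) e)) (h _ (by simp) f)
  · rw [genAlgebra, Algebra.adjoin_eq_span]
    refine Submodule.span_mono fun x hx => ?_
    induction hx using Submonoid.closure_induction with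
    | mem x hx =>
      rcases hx with rfl | rfl | rfl | rfl | rfl | rfl
      · exact ⟨(1, 0, 0, 0, 0, 0), by simp [Sinv]⟩
      · exact ⟨(0, 1, 0, 0, 0, 0), by simp [Sinv]⟩
      · exact ⟨(0, 0, 1, 0, 0, 0), by simp [Sinv]⟩
      · exact ⟨(0, 0, 0, 1, 0, 0), by simp [Sinv]⟩
      · exact ⟨(0, 0, 0, 0, 1, 0), by simp [Sinv]⟩
      · exact ⟨(0, 0, 0, 0, 0, 1), by simp [Sinv]⟩
    | one => exact ⟨(0, 0, 0, 0, 0, 0), by simp [Sinv]⟩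
    | mul x y _ _ hx hy =>
      obtain ⟨⟨a, b, c, d, e, f⟩, rfl⟩ := hx
      obtain ⟨⟨a', b', c', d', e', f'⟩, rfl⟩ := hy
      refine ⟨(a + a', b + b', c + c', d + d', e + e', f + f'), ?_⟩
      simp only [Sinv]
      ring

/-- `(Q^{U_n})^{S₃}` is spanned by the `α₁^a α₂^b α₃^c (γ₁²)^d (γ₂²)^e (γ₁γ₂)^f`; in
particular it is generated as a ℂ-algebra by `α₁, α₂, α₃, γ₁², γ₂², γ₁γ₂`. -/
theorem stmt_16 (n : ℕ) (hn : 3 ≤ n) :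
    ((Submodule.span ℂ (Set.range (Sinv n hn)) : Set (P n)) =
      {f : P n | InQ n f ∧ UInv n f ∧ ∀ σ : Equiv.Perm (Fin 3), permAct n σ f = f}) ∧
    ((Algebra.adjoin ℂ
        {alpha1 n hn, alpha2 n hn, alpha3 n hn, gamma1 n hn ^ 2, gamma2 n hn ^ 2,
          gamma1 n hn * gamma2 n hn} : Set (P n)) =
      {f : P n | InQ n f ∧ UInv n f ∧ ∀ σ : Equiv.Perm (Fin 3), permAct n σ f = f}) := by
  refine ⟨?_, coe_genAlgebra_eq n hn⟩
  rw [span_Sinv_eq]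
  exact coe_genAlgebra_eq n hn
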